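/- Let u be a classical solution of the inequality ∂u/∂t − Σ_{i,j=1}^n a_{ij}(x,u) ∂²u/∂x_i∂x_j + f(x,u,Du) ≤ 0 in ℝ₊^{n+1}, under the structural assumptions on a_{ij}, f, g, h, p, and let θ > 1. There exists a constant C > 0, depending only on n and θ, with the following property: whenever r > 0 and t > 0 satisfy 4r² < t and M₂ := sup_{Q_{2r}^{t−4r²,t}} u ≥ θ^{1/2} · sup_{Q_r^{t−r²,t}} u > 0, then, with M₁ := sup_{Q_r^{t−r²,t}} u, at least one of the following two estimates holds: (i) ∫_{M₁}^{M₂} (g_θ(ζ) ζ)^{−1/2} dζ ≥ C ∫_r^{2r} q^{1/2}(2ρ) dρ; (ii) ∫_{M₁}^{M₂} dζ / h_θ(ζ) ≥ C ∫_r^{2r} ρ q(2ρ) dρ. -/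

import Mathlib

open Set Filter MeasureTheory Metric

noncomputable section

/-- `n`-dimensional Euclidean space. -/
abbrev Eucl (n : ℕ) := EuclideanSpace ℝ (Fin n)

/-- A function on `ℝⁿ` with continuous partial derivatives is differentiable. -/
theorem hasFDerivAt_of_continuous_partials {n : ℕ} {f : Eucl n → ℝ} {f' : Eucl n → Fin n → ℝ}
    (hf : ∀ x i, HasDerivAt (fun s : ℝ => f (x + s • EuclideanSpace.single i (1 : ℝ))) (f' x i) 0)
    (hc : ∀ i, Continuous fun x => f' x i) (x : Eucl n) :
    HasFDerivAt f (∑ i, f' x i • (EuclideanSpace.proj i : Eucl n →L[ℝ] ℝ)) x := by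
  have hf' : ∀ (y : Eucl n) i (s : ℝ),
      HasDerivAt (fun s : ℝ => f (y + s • EuclideanSpace.single i (1 : ℝ)))
        (f' (y + s • EuclideanSpace.single i (1 : ℝ)) i) s := by
    intro y i s
    have h := (hf (y + s • EuclideanSpace.single i (1 : ℝ)) i).scomp_of_eq s
      ((hasDerivAt_id s).sub_const s) (by simp)
    simp only [one_smul] at h
    refine h.congr_of_eventuallyEq (Eventually.of_forall fun τ => ?_)
    simp only [Function.comp, id]
    rw [add_assoc, ← add_smul]
    congr 3
    ring
  have key : ∀ S : Finset (Fin n),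
      (fun v : Eucl n => f (x + ∑ i ∈ S, v i • EuclideanSpace.single i (1 : ℝ)) - f x
        - ∑ i ∈ S, f' x i * v i) =o[nhds 0] fun v => v := by
    intro S
    induction S using Finset.induction_on with
    | empty => simp
    | insert j S hj ih =>
      have hstep : (fun v : Eucl n =>
          f (x + ∑ i ∈ S, v i • EuclideanSpace.single i (1 : ℝ)
            + v j • EuclideanSpace.single j (1 : ℝ))
          - f (x + ∑ i ∈ S, v i • EuclideanSpace.single i (1 : ℝ)) - f' x j * v j)
          =o[nhds 0] fun v => v := by
        rw [Asymptotics.isLittleO_iff]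
        intro ε hε
        have hφ : Continuous fun z : Eucl n × ℝ =>
            f' (x + ∑ i ∈ S, z.1 i • EuclideanSpace.single i (1 : ℝ)
              + z.2 • EuclideanSpace.single j (1 : ℝ)) j := by
          refine (hc j).comp ?_
          fun_prop
        have h1 : ∀ᶠ z : Eucl n × ℝ in nhds (0, 0),
            ‖f' (x + ∑ i ∈ S, z.1 i • EuclideanSpace.single i (1 : ℝ)
              + z.2 • EuclideanSpace.single j (1 : ℝ)) j - f' x j‖ < ε := by
          have := (hφ.tendsto (0, 0))
          simp only [PiLp.zero_apply, zero_smul, Finset.sum_const_zero, add_zero] at this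
          have h2 := (Metric.tendsto_nhds.1 this) ε hε
          simpa [Real.dist_eq] using h2
        obtain ⟨δ, hδ, hball⟩ := Metric.eventually_nhds_iff.1 h1
        filter_upwards [Metric.ball_mem_nhds (0 : Eucl n) hδ] with v hv
        have hvn : ‖v‖ < δ := by simpa using hv
        have hvj : |v j| ≤ ‖v‖ := by simpa using PiLp.norm_apply_le v j
        set y := x + ∑ i ∈ S, v i • EuclideanSpace.single i (1 : ℝ) with hy
        have hd : ∀ s ∈ uIcc 0 (v j), HasDerivWithinAt
            (fun s : ℝ => f (y + s • EuclideanSpace.single j (1 : ℝ)) - f' x j * s)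
            (f' (y + s • EuclideanSpace.single j (1 : ℝ)) j - f' x j * 1) (uIcc 0 (v j)) s :=
          fun s _ => ((hf' y j s).sub ((hasDerivAt_id s).const_mul _)).hasDerivWithinAt
        have hb : ∀ s ∈ uIcc 0 (v j),
            ‖f' (y + s • EuclideanSpace.single j (1 : ℝ)) j - f' x j * 1‖ ≤ ε := by
          intro s hs
          rw [mul_one]
          refine (hball (y := (v, s)) ?_).le
          have hs' : |s| ≤ |v j| := by
            rcases le_total 0 (v j) with h0 | h0
            · rw [uIcc_of_le h0] at hs
              rw [abs_of_nonneg h0, abs_of_nonneg hs.1]; exact hs.2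
            · rw [uIcc_of_ge h0] at hs
              rw [abs_of_nonpos h0, abs_of_nonpos hs.2]; linarith [hs.1]
          rw [Prod.dist_eq, max_lt_iff]
          simp only [dist_zero_right, Real.norm_eq_abs]
          exact ⟨hvn, by linarith⟩
        have := (convex_uIcc 0 (v j)).norm_image_sub_le_of_norm_hasDerivWithin_le hd hb
          left_mem_uIcc right_mem_uIcc
        simp only [zero_smul, add_zero, mul_zero, sub_zero, Real.norm_eq_abs] at this
        rw [Real.norm_eq_abs]
        calc _ = |f (y + v j • EuclideanSpace.single j (1 : ℝ)) - f' x j * v j - f y| := by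
              congr 1; ring
          _ ≤ ε * |v j| := this
          _ ≤ ε * ‖v‖ := by gcongr
      refine (ih.add hstep).congr_left fun v => ?_
      rw [Finset.sum_insert hj, Finset.sum_insert hj]
      have : x + (v j • EuclideanSpace.single j (1 : ℝ)
          + ∑ i ∈ S, v i • EuclideanSpace.single i (1 : ℝ))
          = x + ∑ i ∈ S, v i • EuclideanSpace.single i (1 : ℝ)
            + v j • EuclideanSpace.single j (1 : ℝ) := by abel
      rw [this]
      ring
  rw [hasFDerivAt_iff_isLittleO_nhds_zero]
  refine (key Finset.univ).congr_left fun v => ?_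
  have hv : ∑ i, v i • EuclideanSpace.single i (1 : ℝ) = v := by
    ext k
    simp [Finset.sum_apply, Pi.single_apply]
  rw [hv]
  simp

/-- The second derivative is nonpositive at a local maximum. -/
theorem second_deriv_nonpos_of_isLocalMax {k k' : ℝ → ℝ} {c : ℝ}
    (hk : ∀ s, HasDerivAt k (k' s) s) (hk' : HasDerivAt k' c 0) (hmax : IsLocalMax k 0) :
    c ≤ 0 := by
  by_contra! hc
  have hd : deriv k = k' := funext fun s => (hk s).deriv
  have h0 : deriv k 0 = 0 := hmax.deriv_eq_zero
  have hmin : IsLocalMin k 0 := by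
    refine isLocalMin_of_deriv_deriv_pos ?_ h0 (hk 0).continuousAt
    rw [hd, hk'.deriv]
    exact hc
  have heq : k =ᶠ[nhds 0] fun _ => k 0 := by
    filter_upwards [hmin, hmax] with s h1 h2 using le_antisymm h2 h1
  have h1 : k' =ᶠ[nhds 0] fun _ => (0 : ℝ) := by
    have := heq.deriv
    rw [hd] at this
    simpa using this
  have h2 : HasDerivAt k' 0 0 := (hasDerivAt_const (0 : ℝ) (0 : ℝ)).congr_of_eventuallyEq h1
  exact hc.ne (h2.unique hk')

/-- First and second order necessary conditions at a local maximum, in coordinates. -/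
theorem IsLocalMax.partials {n : ℕ} {f : Eucl n → ℝ} {f₁ : Eucl n → Fin n → ℝ}
    {f₂ : Eucl n → Fin n → Fin n → ℝ}
    (h₁ : ∀ x i, HasDerivAt (fun s : ℝ => f (x + s • EuclideanSpace.single i (1 : ℝ))) (f₁ x i) 0)
    (h₂ : ∀ x i j,
      HasDerivAt (fun s : ℝ => f₁ (x + s • EuclideanSpace.single j (1 : ℝ)) i) (f₂ x i j) 0)
    (c₁ : ∀ i, Continuous fun x => f₁ x i) (c₂ : ∀ i j, Continuous fun x => f₂ x i j)
    {x : Eucl n} (hx : IsLocalMax f x) :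
    (∀ i, f₁ x i = 0) ∧ (∀ i j, f₂ x i j = f₂ x j i) ∧
      ∀ ξ : Fin n → ℝ, ∑ i, ∑ j, f₂ x i j * ξ i * ξ j ≤ 0 := by
  have hF := hasFDerivAt_of_continuous_partials h₁ c₁
  have hG : ∀ i, HasFDerivAt (fun x => f₁ x i)
      (∑ j, f₂ x i j • (EuclideanSpace.proj j : Eucl n →L[ℝ] ℝ)) x := fun i =>
    hasFDerivAt_of_continuous_partials (f := fun x => f₁ x i) (f' := fun x j => f₂ x i j)
      (fun x j => h₂ x i j) (fun j => c₂ i j) x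
  have hGF : HasFDerivAt (fun x => ∑ i, f₁ x i • (EuclideanSpace.proj i : Eucl n →L[ℝ] ℝ))
      (∑ i, (∑ j, f₂ x i j • (EuclideanSpace.proj j : Eucl n →L[ℝ] ℝ)).smulRight
        (EuclideanSpace.proj i : Eucl n →L[ℝ] ℝ)) x :=
    HasFDerivAt.fun_sum fun i _ => (hG i).smul_const (F := Eucl n →L[ℝ] ℝ) _
  refine ⟨fun i => ?_, fun i j => ?_, fun ξ => ?_⟩
  · have h0 := hx.hasFDerivAt_eq_zero (hF x)
    have := congrArg (fun L : Eucl n →L[ℝ] ℝ => L (EuclideanSpace.single i 1)) h0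
    simpa [sum_apply, Pi.single_apply] using this
  · have := second_derivative_symmetric hF hGF (EuclideanSpace.single i 1)
      (EuclideanSpace.single j 1)
    simpa [sum_apply, Pi.single_apply] using this.symm
  · set v : Eucl n := WithLp.toLp 2 ξ with hv
    have hline : ∀ s : ℝ, HasDerivAt (fun s : ℝ => x + s • v) v s := fun s => by
      simpa using ((hasDerivAt_id s).smul_const v).const_add x
    have hk : ∀ s : ℝ, HasDerivAt (fun s : ℝ => f (x + s • v)) (∑ i, f₁ (x + s • v) i * ξ i) s := by
      intro s
      have := (hF (x + s • v)).comp_hasDerivAt s (hline s)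
      simpa [sum_apply, hv, Function.comp_def] using this
    have hk' : HasDerivAt (fun s : ℝ => ∑ i, f₁ (x + s • v) i * ξ i)
        (∑ i, ∑ j, f₂ x i j * ξ i * ξ j) 0 := by
      refine HasDerivAt.fun_sum fun i _ => ?_
      have := ((hG i).comp_hasDerivAt_of_eq 0 (hline 0) (by simp)).mul_const (ξ i)
      simp only [sum_apply, Function.comp_def, Finset.sum_mul, hv,
        smul_apply, PiLp.proj_apply, smul_eq_mul] at this
      exact this.congr_deriv (Finset.sum_congr rfl fun j _ => by ring)
    refine second_deriv_nonpos_of_isLocalMax hk hk' ?_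
    have hcont : ContinuousAt (fun s : ℝ => x + s • v) 0 := (hline 0).continuousAt
    have : Tendsto (fun s : ℝ => x + s • v) (nhds 0) (nhds x) := by
      simpa [ContinuousAt] using hcont
    have h3 := this.eventually hx
    simpa [IsLocalMax, IsMaxFilter] using h3

/-- If `A` has positive semidefinite quadratic form and `S` is symmetric with nonpositive
quadratic form, then `∑ A_{ij} S_{ij} ≤ 0`. -/
theorem sum_mul_nonpos_of_quadratic_forms {n : ℕ} {A S : Fin n → Fin n → ℝ}
    (hA : ∀ ξ : Fin n → ℝ, 0 ≤ ∑ i, ∑ j, A i j * ξ i * ξ j) (hS : ∀ i j, S i j = S j i)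
    (hS' : ∀ ξ : Fin n → ℝ, ∑ i, ∑ j, S i j * ξ i * ξ j ≤ 0) :
    ∑ i, ∑ j, A i j * S i j ≤ 0 := by
  have hpsd : (Matrix.of fun i j => -S i j).PosSemidef := by
    refine Matrix.PosSemidef.of_dotProduct_mulVec_nonneg ?_ fun ξ => ?_
    · ext i j
      simp [Matrix.conjTranspose_apply, hS i j]
    · have := hS' ξ
      simp only [dotProduct, Matrix.mulVec, Matrix.of_apply, star_trivial, Pi.star_apply,
        Finset.mul_sum]
      have h2 : ∑ i, ∑ j, ξ i * (-S i j * ξ j) = -∑ i, ∑ j, S i j * ξ i * ξ j := by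
        simp only [← Finset.sum_neg_distrib]
        exact Finset.sum_congr rfl fun i _ => Finset.sum_congr rfl fun j _ => by ring
      rw [h2]; linarith
  obtain ⟨m, v, hv⟩ := Matrix.posSemidef_iff_eq_sum_vecMulVec.1 hpsd
  have hSv : ∀ i j, S i j = -∑ k, v k i * v k j := by
    intro i j
    have := congrFun (congrFun hv i) j
    simp only [Matrix.of_apply, Matrix.sum_apply, Matrix.vecMulVec_apply, star_trivial] at this
    linarith
  have : ∑ i, ∑ j, A i j * S i j = -∑ k, ∑ i, ∑ j, A i j * v k i * v k j := by
    rw [Finset.sum_comm]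
    simp only [hSv, mul_neg, Finset.sum_neg_distrib, Finset.mul_sum]
    rw [neg_inj]
    rw [Finset.sum_comm]
    calc _ = ∑ i, ∑ k, ∑ j, A i j * v k i * v k j :=
          Finset.sum_congr rfl fun i _ => by
            rw [Finset.sum_comm]
            exact Finset.sum_congr rfl fun k _ => Finset.sum_congr rfl fun j _ => by ring
      _ = _ := Finset.sum_comm
  rw [this]
  have := Finset.sum_nonneg fun k (_ : k ∈ Finset.univ) => hA (v k)
  linarith

theorem hasDerivAt_max_zero_pow (k : ℕ) (y : ℝ) :
    HasDerivAt (fun y : ℝ => max y 0 ^ (k + 2)) ((k + 2) * max y 0 ^ (k + 1)) y := by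
  rcases lt_trichotomy y 0 with hy | rfl | hy
  · rw [max_eq_right hy.le]
    simp only [ne_eq, Nat.add_eq_zero_iff, one_ne_zero, and_false, not_false_eq_true, zero_pow,
      mul_zero]
    refine (hasDerivAt_const y (0 : ℝ)).congr_of_eventuallyEq ?_
    filter_upwards [Iio_mem_nhds hy] with z hz
    rw [max_eq_right (le_of_lt hz)]
    simp
  · simp only [max_self, ne_eq, Nat.add_eq_zero_iff, one_ne_zero, and_false, not_false_eq_true,
      zero_pow, mul_zero]
    rw [hasDerivAt_iff_isLittleO]
    simp only [max_self, smul_zero, sub_zero, ne_eq, Nat.add_eq_zero_iff, OfNat.ofNat_ne_zero,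
      and_false, not_false_eq_true, zero_pow]
    refine Asymptotics.IsBigO.trans_isLittleO (g := fun y : ℝ => y ^ (k + 2)) ?_
      (Asymptotics.isLittleO_pow_id (by omega))
    refine Asymptotics.IsBigO.of_bound 1 (Eventually.of_forall fun z => ?_)
    rw [one_mul, norm_pow, norm_pow]
    gcongr
    rw [Real.norm_eq_abs, Real.norm_eq_abs, abs_of_nonneg (le_max_right _ _)]
    exact max_le (le_abs_self z) (abs_nonneg z)
  · rw [max_eq_left hy.le]
    have h := hasDerivAt_pow (k + 2) y
    push_cast at h
    refine h.congr_of_eventuallyEq ?_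
    filter_upwards [Ioi_mem_nhds hy] with z hz
    rw [max_eq_left (le_of_lt hz)]

theorem hasDerivAt_norm_sq_coord {n : ℕ} (x : Eucl n) (i : Fin n) :
    HasDerivAt (fun s : ℝ => ‖x + s • EuclideanSpace.single i (1 : ℝ)‖ ^ 2) (2 * x i) 0 := by
  have h : (fun s : ℝ => ‖x + s • EuclideanSpace.single i (1 : ℝ)‖ ^ 2)
      = fun s => ‖x‖ ^ 2 + s * (2 * x i) + s ^ 2 := by
    funext s
    rw [norm_add_sq_real, norm_smul, inner_smul_right]
    simp [EuclideanSpace.inner_single_right]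
    ring
  rw [h]
  have := (((hasDerivAt_id (0 : ℝ)).mul_const (2 * x i)).const_add (‖x‖ ^ 2)).fun_add
    (hasDerivAt_pow 2 (0 : ℝ))
  simpa using this

theorem hasDerivAt_cubic_barrier {n : ℕ} (B c : ℝ) (x : Eucl n) (i : Fin n) :
    HasDerivAt
      (fun s : ℝ => B * max (‖x + s • EuclideanSpace.single i (1 : ℝ)‖ ^ 2 - c) 0 ^ 3)
      (6 * B * max (‖x‖ ^ 2 - c) 0 ^ 2 * x i) 0 := by
  have h := ((hasDerivAt_max_zero_pow 1 (‖x‖ ^ 2 - c)).comp_of_eq 0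
    ((hasDerivAt_norm_sq_coord x i).sub_const c) (by simp)).const_mul B
  refine h.congr_deriv ?_
  push_cast
  ring

theorem hasDerivAt_cubic_barrier_gradient {n : ℕ} (B c : ℝ) (x : Eucl n) (i j : Fin n) :
    HasDerivAt
      (fun s : ℝ => 6 * B * max (‖x + s • EuclideanSpace.single j (1 : ℝ)‖ ^ 2 - c) 0 ^ 2
        * (x + s • EuclideanSpace.single j (1 : ℝ)) i)
      (24 * B * max (‖x‖ ^ 2 - c) 0 * x i * x j
        + 6 * B * max (‖x‖ ^ 2 - c) 0 ^ 2 * (if i = j then 1 else 0)) 0 := by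
  have h := ((hasDerivAt_max_zero_pow 0 (‖x‖ ^ 2 - c)).comp_of_eq 0
    ((hasDerivAt_norm_sq_coord x j).sub_const c) (by simp)).const_mul (6 * B)
  have h2 : HasDerivAt (fun s : ℝ => (x + s • EuclideanSpace.single j (1 : ℝ)) i)
      (if i = j then 1 else 0) 0 := by
    simp only [PiLp.add_apply, PiLp.smul_apply, PiLp.single_apply, smul_eq_mul]
    simpa using ((hasDerivAt_id (0 : ℝ)).mul_const (if i = j then (1 : ℝ) else 0)).const_add (x i)
  refine (h.mul h2).congr_deriv ?_
  simp only [zero_smul, add_zero, Function.comp_apply]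
  push_cast
  ring

theorem HasDerivAt.nonneg_of_le_left {k : ℝ → ℝ} {D a b : ℝ} (hk : HasDerivAt k D b) (hab : a < b)
    (hle : ∀ s ∈ Ioo a b, k s ≤ k b) : 0 ≤ D := by
  have h := (hasDerivWithinAt_iff_tendsto_slope' (s := Iio b) (by simp)).1
    (hk.hasDerivWithinAt (s := Iio b))
  refine ge_of_tendsto h ?_
  filter_upwards [Ioo_mem_nhdsLT hab] with s hs
  rw [slope_def_field]
  exact div_nonneg_of_nonpos (by linarith [hle s hs]) (by linarith [hs.2])

set_option maxHeartbeats 1000000 in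
/-- Comparison with a cubic barrier: an increase `m₂ - m₁` of the maximum of a subsolution between
two concentric parabolic cylinders cannot be too small. -/
theorem subsolution_max_growth {n : ℕ}
    {a : Eucl n → ℝ → Fin n → Fin n → ℝ} {f : Eucl n → ℝ → Eucl n → ℝ}
    {g h : ℝ → ℝ} {p : Eucl n → ℝ}
    {u : Eucl n → ℝ → ℝ} {du : Eucl n → ℝ → Eucl n}
    {d2u : Eucl n → ℝ → Fin n → Fin n → ℝ} {ut : Eucl n → ℝ → ℝ}
    (hell : ∀ (x : Eucl n) (ζ : ℝ), ζ ≠ 0 → ∀ ξ : Eucl n, ξ ≠ 0 →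
      0 < ∑ i, ∑ j, a x ζ i j * ξ i * ξ j)
    (hst : ∀ (x : Eucl n) (ζ : ℝ), 0 < ζ → ∀ lam : ℝ, 0 ≤ lam → lam ≤ p x * h ζ →
      p x * g ζ * (1 + ∑ i, ∑ j, |a x ζ i j|) ≤ f x ζ (lam • x))
    (hdu : ∀ (x : Eucl n) (t : ℝ), 0 < t → ∀ i,
      HasDerivAt (fun s : ℝ => u (x + s • EuclideanSpace.single i (1 : ℝ)) t) (du x t i) 0)
    (hd2u : ∀ (x : Eucl n) (t : ℝ), 0 < t → ∀ i j,
      HasDerivAt (fun s : ℝ => du (x + s • EuclideanSpace.single j (1 : ℝ)) t i)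
        (d2u x t i j) 0)
    (hut : ∀ (x : Eucl n) (t : ℝ), 0 < t → HasDerivAt (fun τ : ℝ => u x τ) (ut x t) t)
    (cu : ContinuousOn (fun q : Eucl n × ℝ => u q.1 q.2) (univ ×ˢ Ioi 0))
    (cdu : ∀ i, ContinuousOn (fun q : Eucl n × ℝ => du q.1 q.2 i) (univ ×ˢ Ioi 0))
    (cd2u : ∀ i j, ContinuousOn (fun q : Eucl n × ℝ => d2u q.1 q.2 i j) (univ ×ˢ Ioi 0))
    (hpde : ∀ (x : Eucl n) (t : ℝ), 0 < t →
      ut x t - (∑ i, ∑ j, a x (u x t) i j * d2u x t i j) + f x (u x t) (du x t) ≤ 0)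
    {r t ρ₁ ρ₂ m₁ m₂ Q γ η : ℝ} (hr : 0 < r) (ht : 4 * r ^ 2 < t) (h₁ : r ≤ ρ₁) (h₁₂ : ρ₁ < ρ₂)
    (h₂ : ρ₂ ≤ 2 * r) (hm₁ : 0 < m₁) (hm : m₁ < m₂)
    (hle : ∀ x s, ‖x‖ ≤ ρ₂ → s ∈ Icc (t - ρ₂ ^ 2) t → u x s ≤ m₂)
    (hex : ∃ x s, ‖x‖ ≤ ρ₁ ∧ s ∈ Icc (t - ρ₁ ^ 2) t ∧ u x s = m₁)
    (hQ₀ : 0 ≤ Q) (hQ : ∀ x, ‖x‖ < 2 * r → Q ≤ p x)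
    (hγ₀ : 0 ≤ γ) (hγ : ∀ s ∈ Icc m₁ m₂, γ ≤ g s)
    (hη₀ : 0 ≤ η) (hη : ∀ s ∈ Icc m₁ m₂, η ≤ h s) :
    (ρ₂ - ρ₁) ^ 2 * (Q * γ) ≤ 54 * (m₂ - m₁) ∨ r * (ρ₂ - ρ₁) * (Q * η) ≤ 6 * (m₂ - m₁) := by
  by_contra! hcon
  obtain ⟨hA, hB⟩ := hcon
  obtain ⟨x₁, s₁, hx₁, hs₁, hu₁⟩ := hex
  set δ := m₂ - m₁ with hδ
  set Δ := ρ₂ - ρ₁ with hΔ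
  have hδ0 : 0 < δ := by linarith
  have hΔ0 : 0 < Δ := by linarith
  have hΔr : Δ ≤ r := by linarith
  have hρ₂t : ρ₂ ^ 2 < t := by nlinarith
  set D := ρ₂ ^ 2 - ρ₁ ^ 2 with hD
  have hDΔ : 2 * r * Δ ≤ D := by nlinarith
  have hD0 : 0 < D := lt_of_lt_of_le (by positivity) hDΔ
  set B := 2 * δ / D ^ 3 with hBdef
  have hB0 : 0 < B := by positivity
  have hBD3 : B * D ^ 3 = 2 * δ := by rw [hBdef]; field_simp
  have hBD2 : B * D ^ 2 ≤ δ / (r * Δ) := by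
    have : B * D ^ 2 = 2 * δ / D := by rw [hBdef]; field_simp
    rw [this, div_le_div_iff₀ hD0 (by positivity)]
    nlinarith
  have hBD1 : B * D * (4 * r ^ 2) ≤ 2 * δ / Δ ^ 2 := by
    have : B * D * (4 * r ^ 2) = 2 * δ * (4 * r ^ 2) / D ^ 2 := by rw [hBdef]; field_simp
    rw [this, div_le_div_iff₀ (by positivity) (by positivity)]
    have : (2 * r * Δ) ^ 2 ≤ D ^ 2 := by gcongr
    nlinarith
  have hrΔ : δ / (r * Δ) ≤ δ / Δ ^ 2 := by
    rw [pow_two]; gcongr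
  -- the barrier
  let W : Eucl n → ℝ := fun x => B * max (‖x‖ ^ 2 - ρ₁ ^ 2) 0 ^ 3
  let T : ℝ → ℝ := fun s => B * max (t - ρ₁ ^ 2 - s) 0 ^ 3
  have hW0 : ∀ x, 0 ≤ W x := fun x => by positivity
  have hT0 : ∀ s, 0 ≤ T s := fun s => by positivity
  have hWc : Continuous W := by fun_prop
  have hTc : Continuous T := by fun_prop
  have hK : IsCompact (closedBall (0 : Eucl n) ρ₂ ×ˢ Icc (t - ρ₂ ^ 2) t) :=
    (isCompact_closedBall _ _).prod isCompact_Icc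
  have hmem₁ : (x₁, s₁) ∈ closedBall (0 : Eucl n) ρ₂ ×ˢ Icc (t - ρ₂ ^ 2) t := by
    refine ⟨by simpa using hx₁.trans h₁₂.le, ?_, hs₁.2⟩
    have := hs₁.1
    simp only
    linarith
  obtain ⟨⟨x₀, s₀⟩, ⟨hx₀, hs₀⟩, hmax⟩ := hK.exists_isMaxOn ⟨_, hmem₁⟩
    (f := fun q : Eucl n × ℝ => u q.1 q.2 - W q.1 - T q.2) (by
      refine ((cu.mono ?_).sub (by fun_prop)).sub (by fun_prop)
      rintro ⟨x, s⟩ ⟨-, hs⟩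
      exact ⟨mem_univ _, by have := hs.1; simp only [mem_Ioi] at *; linarith⟩)
  have hmax' : ∀ x s, ‖x‖ ≤ ρ₂ → s ∈ Icc (t - ρ₂ ^ 2) t →
      u x s - W x - T s ≤ u x₀ s₀ - W x₀ - T s₀ := fun x s hx hs =>
    hmax (a := (x, s)) ⟨by simpa using hx, hs⟩
  simp only [mem_closedBall, dist_zero_right] at hx₀ hs₀
  have hm₁v : m₁ ≤ u x₀ s₀ - W x₀ - T s₀ := by
    have h := hmax' x₁ s₁ (hx₁.trans h₁₂.le) hmem₁.2
    have hW1 : W x₁ = 0 := by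
      have : ‖x₁‖ ^ 2 - ρ₁ ^ 2 ≤ 0 := by nlinarith [norm_nonneg x₁]
      simp [W, max_eq_right this]
    have hT1 : T s₁ = 0 := by
      have : t - ρ₁ ^ 2 - s₁ ≤ 0 := by linarith [hs₁.1]
      simp [T, max_eq_right this]
    rw [hW1, hT1, hu₁] at h
    linarith
  have hu₂ := hle x₀ s₀ hx₀ hs₀
  have hx₀' : ‖x₀‖ < ρ₂ := by
    refine lt_of_le_of_ne hx₀ fun heq => ?_
    have : W x₀ = 2 * δ := by
      simp only [W, heq]
      rw [← hD, max_eq_left hD0.le, hBD3]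
    linarith [hT0 s₀]
  have hs₀' : t - ρ₂ ^ 2 < s₀ := by
    refine lt_of_le_of_ne hs₀.1 fun heq => ?_
    have : T s₀ = 2 * δ := by
      simp only [T, ← heq]
      rw [show t - ρ₁ ^ 2 - (t - ρ₂ ^ 2) = D by rw [hD]; ring, max_eq_left hD0.le, hBD3]
    linarith [hW0 x₀]
  have hs₀0 : 0 < s₀ := by linarith
  have hu₁₂ : u x₀ s₀ ∈ Icc m₁ m₂ := ⟨by linarith [hW0 x₀, hT0 s₀], hu₂⟩
  have hu0 : 0 < u x₀ s₀ := hm₁.trans_le hu₁₂.1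
  set A := max (‖x₀‖ ^ 2 - ρ₁ ^ 2) 0 with hAdef
  have hA0 : 0 ≤ A := le_max_right _ _
  have hAD : A ≤ D := max_le (by nlinarith [norm_nonneg x₀]) hD0.le
  have hslice : Continuous fun x : Eucl n => (x, s₀) := by fun_prop
  have hsl : ∀ x : Eucl n, (x, s₀) ∈ (univ : Set (Eucl n)) ×ˢ Ioi (0 : ℝ) :=
    fun x => ⟨mem_univ _, hs₀0⟩
  -- spatial conditions at the maximum
  have hloc : IsLocalMax (fun x => u x s₀ - W x) x₀ := by
    have : ball (0 : Eucl n) ρ₂ ∈ nhds x₀ := isOpen_ball.mem_nhds (by simpa using hx₀')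
    filter_upwards [this] with x hx
    have := hmax' x s₀ (by simpa using (mem_ball_zero_iff.1 hx).le) hs₀
    linarith
  obtain ⟨hgrad, hsymm, hhess⟩ := IsLocalMax.partials
    (f₁ := fun x i => du x s₀ i - 6 * B * max (‖x‖ ^ 2 - ρ₁ ^ 2) 0 ^ 2 * x i)
    (f₂ := fun x i j => d2u x s₀ i j - (24 * B * max (‖x‖ ^ 2 - ρ₁ ^ 2) 0 * x i * x j
        + 6 * B * max (‖x‖ ^ 2 - ρ₁ ^ 2) 0 ^ 2 * (if i = j then 1 else 0)))
    (fun x i => (hdu x s₀ hs₀0 i).sub (hasDerivAt_cubic_barrier B (ρ₁ ^ 2) x i))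
    (fun x i j => (hd2u x s₀ hs₀0 i j).sub (hasDerivAt_cubic_barrier_gradient B (ρ₁ ^ 2) x i j))
    (fun i => ((cdu i).comp_continuous hslice hsl).sub (by fun_prop))
    (fun i j => ((cd2u i j).comp_continuous hslice hsl).sub (by fun_prop)) hloc
  have hgrad_eq : du x₀ s₀ = (6 * B * A ^ 2) • x₀ := by
    ext i
    have := hgrad i
    simp only [PiLp.smul_apply, smul_eq_mul]
    linarith
  have htrace := sum_mul_nonpos_of_quadratic_forms (A := a x₀ (u x₀ s₀)) (fun ξ => by
    by_cases hξ : ξ = 0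
    · simp [hξ]
    · refine (hell x₀ _ hu0.ne' (WithLp.toLp 2 ξ) fun h0 => hξ ?_).le
      simpa using h0) hsymm hhess
  -- temporal condition at the maximum
  have htime : 0 ≤ ut x₀ s₀ + 3 * B * max (t - ρ₁ ^ 2 - s₀) 0 ^ 2 := by
    have hT : HasDerivAt T (-(3 * B * max (t - ρ₁ ^ 2 - s₀) 0 ^ 2)) s₀ := by
      have := ((hasDerivAt_max_zero_pow 1 (t - ρ₁ ^ 2 - s₀)).comp s₀
        ((hasDerivAt_id s₀).const_sub (t - ρ₁ ^ 2))).const_mul B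
      refine this.congr_deriv ?_
      push_cast
      ring
    have := ((hut x₀ s₀ hs₀0).sub hT).nonneg_of_le_left hs₀' fun s hs => by
      have := hmax' x₀ s hx₀ ⟨hs.1.le, hs.2.le.trans hs₀.2⟩
      simp only [Pi.sub_apply]
      linarith
    linarith
  -- bounds on the derivatives of the barrier
  have hBA2 : B * A ^ 2 ≤ δ / (r * Δ) := le_trans (by gcongr) hBD2
  have hBT2 : B * max (t - ρ₁ ^ 2 - s₀) 0 ^ 2 ≤ δ / Δ ^ 2 := by
    refine le_trans ?_ (hBD2.trans hrΔ)
    have : max (t - ρ₁ ^ 2 - s₀) 0 ≤ D := max_le (by linarith) hD0.le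
    gcongr
  set e := δ / Δ ^ 2 with he
  have he0 : 0 < e := by positivity
  have hcoord : ∀ i, |x₀ i| ≤ 2 * r := fun i => by
    have : |x₀ i| ≤ ‖x₀‖ := by simpa using PiLp.norm_apply_le x₀ i
    linarith
  have hHess : ∀ i j, |24 * B * A * x₀ i * x₀ j + 6 * B * A ^ 2 * (if i = j then 1 else 0)|
      ≤ 54 * e := by
    intro i j
    have h1 : |24 * B * A * x₀ i * x₀ j| ≤ 48 * e := by
      rw [abs_mul, abs_mul, abs_of_nonneg (by positivity : 0 ≤ 24 * B * A)]
      calc 24 * B * A * |x₀ i| * |x₀ j| ≤ 24 * B * D * (2 * r) * (2 * r) := by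
            gcongr <;> apply hcoord
        _ = 24 * (B * D * (4 * r ^ 2)) := by ring
        _ ≤ 24 * (2 * δ / Δ ^ 2) := by gcongr
        _ = 48 * e := by rw [he]; ring
    have h2 : |6 * B * A ^ 2 * (if i = j then (1 : ℝ) else 0)| ≤ 6 * e := by
      rw [abs_mul, abs_of_nonneg (by positivity : 0 ≤ 6 * B * A ^ 2)]
      have : |if i = j then (1 : ℝ) else 0| ≤ 1 := by split_ifs <;> simp
      calc 6 * B * A ^ 2 * |if i = j then (1 : ℝ) else 0| ≤ 6 * B * A ^ 2 * 1 := by gcongr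
        _ ≤ 6 * e := by linarith
    calc _ ≤ _ := abs_add_le _ _
      _ ≤ 54 * e := by linarith
  have hQp := hQ x₀ (hx₀'.trans_le h₂)
  have hlam : 6 * B * A ^ 2 ≤ p x₀ * h (u x₀ s₀) := by
    have h1 : 6 * (δ / (r * Δ)) ≤ Q * η := by
      rw [← mul_div_assoc, div_le_iff₀ (by positivity)]
      linarith
    have h2 : Q * η ≤ p x₀ * h (u x₀ s₀) :=
      mul_le_mul hQp (hη _ hu₁₂) hη₀ (hQ₀.trans hQp)
    linarith
  have hf := hst x₀ (u x₀ s₀) hu0 (6 * B * A ^ 2) (by positivity) hlam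
  rw [← hgrad_eq] at hf
  have hpd := hpde x₀ s₀ hs₀0
  set N := ∑ i, ∑ j, |a x₀ (u x₀ s₀) i j| with hN
  have hN0 : 0 ≤ N := Finset.sum_nonneg fun i _ => Finset.sum_nonneg fun j _ => abs_nonneg _
  have hsum : ∑ i, ∑ j, a x₀ (u x₀ s₀) i j * d2u x₀ s₀ i j ≤ 54 * e * N := by
    calc ∑ i, ∑ j, a x₀ (u x₀ s₀) i j * d2u x₀ s₀ i j
        ≤ ∑ i, ∑ j, a x₀ (u x₀ s₀) i j *
          (24 * B * A * x₀ i * x₀ j + 6 * B * A ^ 2 * (if i = j then 1 else 0)) := by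
          rw [← sub_nonpos, ← Finset.sum_sub_distrib]
          simp only [← Finset.sum_sub_distrib, ← mul_sub]
          exact htrace
      _ ≤ ∑ i, ∑ j, 54 * e * |a x₀ (u x₀ s₀) i j| := by
          refine Finset.sum_le_sum fun i _ => Finset.sum_le_sum fun j _ => ?_
          refine (le_abs_self _).trans ?_
          rw [abs_mul, mul_comm]
          gcongr
          exact hHess i j
      _ = 54 * e * N := by simp only [hN, Finset.mul_sum]
  have hE : 54 * e < Q * γ := by
    rw [he, ← mul_div_assoc, div_lt_iff₀ (by positivity)]
    linarith
  have hpg : Q * γ ≤ p x₀ * g (u x₀ s₀) :=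
    mul_le_mul hQp (hγ _ hu₁₂) hγ₀ (hQ₀.trans hQp)
  have h1 : p x₀ * g (u x₀ s₀) * (1 + N) ≤ 54 * e * (1 + N) := by nlinarith
  nlinarith

theorem sSup_image_closure_eq {X : Type*} [TopologicalSpace X] {v : X → ℝ} (hv : Continuous v)
    {O : Set X} (hO : O.Nonempty) (hK : IsCompact (closure O)) :
    sSup (v '' O) = sSup (v '' closure O) := by
  have hb : BddAbove (v '' closure O) := (hK.image hv).bddAbove
  refine le_antisymm (csSup_le_csSup hb (hO.image v) (image_mono subset_closure)) ?_
  refine csSup_le (hO.closure.image v) ?_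
  rintro _ ⟨q, hq, rfl⟩
  have hcl : IsClosed {q | v q ≤ sSup (v '' O)} := isClosed_le hv continuous_const
  refine closure_minimal (fun q hq => ?_) hcl hq
  exact le_csSup (hb.mono (image_mono subset_closure)) (mem_image_of_mem v hq)

theorem continuousOn_sSup_cylinder {n : ℕ} {v : Eucl n × ℝ → ℝ} (hv : Continuous v) (t : ℝ) :
    ContinuousOn (fun ρ => sSup (v '' (closedBall (0 : Eucl n) ρ ×ˢ Icc (t - ρ ^ 2) t)))
      (Ioi 0) := by
  have hK : IsCompact (closedBall (0 : Eucl n) 1 ×ˢ Icc (0 : ℝ) 1) :=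
    (isCompact_closedBall _ _).prod isCompact_Icc
  have hc := hK.continuous_sSup (f := fun (ρ : ℝ) (y : Eucl n × ℝ) => v (ρ • y.1, t - ρ ^ 2 * y.2))
    (by fun_prop)
  refine hc.continuousOn.congr fun ρ hρ => ?_
  have hρ : 0 < ρ := hρ
  simp only
  congr 1
  ext z
  constructor
  · rintro ⟨⟨x, s⟩, ⟨hx, hs⟩, rfl⟩
    simp only [mem_closedBall, dist_zero_right, mem_Icc] at hx hs
    refine ⟨(ρ⁻¹ • x, (t - s) / ρ ^ 2), ⟨?_, ?_, ?_⟩, ?_⟩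
    · simp only [mem_closedBall, dist_zero_right, norm_smul, norm_inv, Real.norm_eq_abs,
        abs_of_pos hρ]
      rw [inv_mul_le_iff₀ hρ]
      linarith
    · exact div_nonneg (by linarith) (by positivity)
    · simp only
      rw [div_le_one (by positivity)]
      linarith
    · simp only
      rw [smul_inv_smul₀ hρ.ne', mul_div_cancel₀ _ (by positivity)]
      congr 2
      ring
  · rintro ⟨⟨y, σ⟩, ⟨hy, hσ⟩, rfl⟩
    simp only [mem_closedBall, dist_zero_right, mem_Icc] at hy hσ
    refine ⟨_, ⟨?_, ?_, ?_⟩, rfl⟩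
    · simp only [mem_closedBall, dist_zero_right, norm_smul, Real.norm_eq_abs, abs_of_pos hρ]
      nlinarith
    · simp only
      nlinarith [sq_nonneg ρ]
    · simp only
      nlinarith [sq_nonneg ρ]

/-- Summing a growth estimate along a geometric sequence of values of a continuous function. -/
theorem sub_le_of_geometric_steps {N : ℝ → ℝ} {Φ : ℝ → ℝ → ℝ} {σ r R : ℝ} (hσ : 1 < σ)
    (hN : ContinuousOn N (Icc r R))
    (hΦ : ∀ a b c, 0 < a → a ≤ b → b ≤ c → Φ a b + Φ b c = Φ a c)
    (hstep : ∀ ρ₁ ρ₂, r ≤ ρ₁ → ρ₁ < ρ₂ → ρ₂ ≤ R → 0 < N ρ₁ → σ * N ρ₁ ≤ N ρ₂ →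
      N ρ₂ ≤ σ ^ 2 * N ρ₁ → ρ₂ - ρ₁ ≤ Φ (N ρ₁) (N ρ₂))
    (hrR : r < R) (hr : 0 < N r) (hR : σ * N r ≤ N R) : R - r ≤ Φ (N r) (N R) := by
  have key : ∀ k : ℕ, ∀ ρ₁, r ≤ ρ₁ → ρ₁ < R → 0 < N ρ₁ → σ * N ρ₁ ≤ N R →
      N R ≤ σ ^ (k + 2) * N ρ₁ → R - ρ₁ ≤ Φ (N ρ₁) (N R) := by
    intro k
    induction k with
    | zero => exact fun ρ₁ h1 h12 h0 hl hu => hstep ρ₁ R h1 h12 le_rfl h0 hl hu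
    | succ k ih =>
      intro ρ₁ h1 h12 h0 hl hu
      by_cases hc : N R ≤ σ ^ 2 * N ρ₁
      · exact hstep ρ₁ R h1 h12 le_rfl h0 hl hc
      push Not at hc
      have hσN : N ρ₁ < σ * N ρ₁ := by nlinarith
      obtain ⟨ρ', ⟨ha, hb⟩, hρ'⟩ := intermediate_value_Icc h12.le
        (hN.mono (Icc_subset_Icc_left h1)) ⟨hσN.le, hl⟩
      have hlt : σ * N ρ₁ < N R := by nlinarith
      have ha' : ρ₁ < ρ' := lt_of_le_of_ne ha (by rintro rfl; linarith)
      have hb' : ρ' < R := lt_of_le_of_ne hb (by rintro rfl; linarith)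
      have s1 := hstep ρ₁ ρ' h1 ha' hb h0 hρ'.ge (by rw [hρ']; nlinarith)
      have s2 := ih ρ' (h1.trans ha) hb' (by rw [hρ']; linarith) (by rw [hρ']; nlinarith)
        (by rw [hρ']; calc N R ≤ σ ^ (k + 1 + 2) * N ρ₁ := hu
              _ = _ := by ring)
      have := hΦ (N ρ₁) (N ρ') (N R) h0 (by linarith) (by linarith)
      linarith
  obtain ⟨k, hk⟩ := pow_unbounded_of_one_lt (N R / N r) hσ
  refine key k r le_rfl hrR hr hR ?_
  rw [div_lt_iff₀ hr] at hk
  have : σ ^ k ≤ σ ^ (k + 2) := pow_le_pow_right₀ hσ.le (by omega)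
  nlinarith

theorem sInf_image_Ioo_lower {φ : ℝ → ℝ} {θ : ℝ} (hθ : 1 < θ)
    (hpos : ∀ s : ℝ, 0 < s → 0 < φ s)
    (hinf : ∀ K : Set ℝ, IsCompact K → K ⊆ Ioi 0 → K.Nonempty → 0 < sInf (φ '' K))
    {m₁ m₂ : ℝ} (hm₁ : 0 < m₁) (hm : m₁ ≤ m₂) :
    ∃ κ, 0 < κ ∧ ∀ ζ ∈ Icc m₁ m₂, κ ≤ sInf (φ '' Ioo (ζ / θ) (θ * ζ)) := by
  have hθ0 : 0 < θ := by linarith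
  have hsub : Icc (m₁ / θ) (θ * m₂) ⊆ Ioi 0 := fun s hs =>
    lt_of_lt_of_le (by positivity : 0 < m₁ / θ) hs.1
  have hle : m₁ / θ ≤ θ * m₂ := by
    rw [div_le_iff₀ hθ0]; nlinarith [mul_pos hm₁ hθ0, mul_pos hθ0 hθ0]
  refine ⟨_, hinf _ isCompact_Icc hsub (nonempty_Icc.2 hle), fun ζ hζ => ?_⟩
  have hζ0 : 0 < ζ := hm₁.trans_le hζ.1
  refine csInf_le_csInf ⟨0, ?_⟩ (Nonempty.image _ (nonempty_Ioo.2 ?_)) (image_mono fun s hs => ?_)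
  · rintro _ ⟨s, hs, rfl⟩
    exact (hpos s (hsub hs)).le
  · rw [div_lt_iff₀ hθ0]; nlinarith [mul_pos hζ0 hθ0]
  · exact ⟨le_trans (by gcongr; exact hζ.1) hs.1.le, hs.2.le.trans (by gcongr; exact hζ.2)⟩

theorem measurable_indicator_sInf_image_Ioo {φ : ℝ → ℝ} {θ : ℝ} (hθ : 1 < θ)
    (hpos : ∀ s : ℝ, 0 < s → 0 < φ s) :
    Measurable ((Ioi (0 : ℝ)).indicator fun ζ => sInf (φ '' Ioo (ζ / θ) (θ * ζ))) := by
  have hθ0 : 0 < θ := by linarith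
  refine measurable_of_Iio fun c => ?_
  have hset : (Ioi (0 : ℝ)).indicator (fun ζ => sInf (φ '' Ioo (ζ / θ) (θ * ζ))) ⁻¹' Iio c
      = (Iic 0 ∩ {_ζ | 0 < c}) ∪
        (Ioi 0 ∩ ⋃ s ∈ {s | φ s < c}, {ζ | ζ / θ < s} ∩ {ζ | s < θ * ζ}) := by
    ext ζ
    by_cases hζ : 0 < ζ
    · have hne : (φ '' Ioo (ζ / θ) (θ * ζ)).Nonempty := by
        refine Nonempty.image _ (nonempty_Ioo.2 ?_)
        rw [div_lt_iff₀ hθ0]; nlinarith [mul_pos hζ hθ0]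
      have hb : BddBelow (φ '' Ioo (ζ / θ) (θ * ζ)) := by
        refine ⟨0, ?_⟩
        rintro _ ⟨s, hs, rfl⟩
        exact (hpos s (lt_trans (by positivity) hs.1)).le
      simp only [mem_preimage, indicator_of_mem (mem_Ioi.2 hζ), mem_Iio, csInf_lt_iff hb hne]
      simp only [exists_mem_image]
      simp [hζ, not_le.2 hζ]
      grind
    · simp [hζ, not_lt.1 hζ]
  rw [hset]
  refine (measurableSet_Iic.inter (MeasurableSet.const _)).union (measurableSet_Ioi.inter ?_)
  refine IsOpen.measurableSet (isOpen_biUnion fun s _ => ?_)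
  exact (isOpen_lt (by fun_prop) continuous_const).inter (isOpen_lt continuous_const (by fun_prop))

/-- Expressions bounded in terms of a positive lower bound of `φ_θ` are integrable. -/
theorem intervalIntegrable_comp_sInf_image_Ioo {φ : ℝ → ℝ} {θ : ℝ} (hθ : 1 < θ)
    (hpos : ∀ s : ℝ, 0 < s → 0 < φ s) {Ψ : ℝ → ℝ → ℝ} (hΨ : Measurable (Function.uncurry Ψ))
    {m₁ m₂ : ℝ} (hm₁ : 0 < m₁) (hm : m₁ ≤ m₂) {c : ℝ}
    (hbd : ∀ ζ ∈ Icc m₁ m₂, ‖Ψ (sInf (φ '' Ioo (ζ / θ) (θ * ζ))) ζ‖ ≤ c) :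
    IntervalIntegrable (fun ζ => Ψ (sInf (φ '' Ioo (ζ / θ) (θ * ζ))) ζ) volume m₁ m₂ := by
  rw [intervalIntegrable_iff_integrableOn_Ioc_of_le hm]
  have hmeas := hΨ.comp ((measurable_indicator_sInf_image_Ioo hθ hpos).prodMk measurable_id)
  have heq : EqOn (fun ζ => Function.uncurry Ψ
      ((Ioi (0 : ℝ)).indicator (fun ζ => sInf (φ '' Ioo (ζ / θ) (θ * ζ))) ζ, ζ))
      (fun ζ => Ψ (sInf (φ '' Ioo (ζ / θ) (θ * ζ))) ζ) (Ioc m₁ m₂) := fun ζ hζ => by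
    have : ζ ∈ Ioi (0 : ℝ) := hm₁.trans hζ.1
    simp [indicator_of_mem this, Function.uncurry]
  refine IntegrableOn.congr_fun ?_ heq measurableSet_Ioc
  refine Measure.integrableOn_of_bounded (M := c) (by simp) hmeas.aestronglyMeasurable ?_
  filter_upwards [ae_restrict_mem measurableSet_Ioc] with ζ hζ
  have h := heq hζ
  simp only at h
  rw [h]
  exact hbd ζ ⟨hζ.1.le, hζ.2⟩

theorem sInf_image_Ioo_le_sInf_image_Icc {φ : ℝ → ℝ} {θ m₁ m₂ ζ : ℝ} (hθ : 1 < θ)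
    (hpos : ∀ s : ℝ, 0 < s → 0 < φ s) (hm₁ : 0 < m₁) (hm₂ : m₂ ≤ θ * m₁) (hζ : ζ ∈ Ioo m₁ m₂) :
    sInf (φ '' Ioo (ζ / θ) (θ * ζ)) ≤ sInf (φ '' Icc m₁ m₂) := by
  have hθ0 : 0 < θ := by linarith
  have hζ0 : 0 < ζ := hm₁.trans hζ.1
  refine csInf_le_csInf ⟨0, ?_⟩ (Nonempty.image _ (nonempty_Icc.2 (hζ.1.trans hζ.2).le))
    (image_mono fun s hs => ⟨?_, ?_⟩)
  · rintro _ ⟨s, hs, rfl⟩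
    exact (hpos s (lt_trans (by positivity) hs.1)).le
  · rw [div_lt_iff₀ hθ0]
    nlinarith [hζ.2, hs.1]
  · nlinarith [hζ.1, hs.2]

theorem intervalIntegrable_inv_sqrt_sInf_mul {g : ℝ → ℝ} {θ : ℝ} (hθ : 1 < θ)
    (hpos : ∀ s : ℝ, 0 < s → 0 < g s)
    (hinf : ∀ K : Set ℝ, IsCompact K → K ⊆ Ioi 0 → K.Nonempty → 0 < sInf (g '' K))
    {m₁ m₂ : ℝ} (hm₁ : 0 < m₁) (hm : m₁ ≤ m₂) :
    IntervalIntegrable (fun ζ => (Real.sqrt (sInf (g '' Ioo (ζ / θ) (θ * ζ)) * ζ))⁻¹)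
      volume m₁ m₂ := by
  obtain ⟨κ, hκ, hle⟩ := sInf_image_Ioo_lower hθ hpos hinf hm₁ hm
  refine intervalIntegrable_comp_sInf_image_Ioo hθ hpos (Ψ := fun y ζ => (Real.sqrt (y * ζ))⁻¹)
    (by unfold Function.uncurry; fun_prop) hm₁ hm (c := (Real.sqrt (κ * m₁))⁻¹) fun ζ hζ => ?_
  rw [Real.norm_eq_abs, abs_of_nonneg (by positivity)]
  have := hle ζ hζ
  have h2 := hζ.1
  have h3 := hκ.le.trans this
  gcongr

theorem intervalIntegrable_inv_sInf {h : ℝ → ℝ} {θ : ℝ} (hθ : 1 < θ)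
    (hpos : ∀ s : ℝ, 0 < s → 0 < h s)
    (hinf : ∀ K : Set ℝ, IsCompact K → K ⊆ Ioi 0 → K.Nonempty → 0 < sInf (h '' K))
    {m₁ m₂ : ℝ} (hm₁ : 0 < m₁) (hm : m₁ ≤ m₂) :
    IntervalIntegrable (fun ζ => (sInf (h '' Ioo (ζ / θ) (θ * ζ)))⁻¹) volume m₁ m₂ := by
  obtain ⟨κ, hκ, hle⟩ := sInf_image_Ioo_lower hθ hpos hinf hm₁ hm
  refine intervalIntegrable_comp_sInf_image_Ioo hθ hpos (Ψ := fun y _ => y⁻¹)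
    (by unfold Function.uncurry; fun_prop) hm₁ hm (c := κ⁻¹) fun ζ hζ => ?_
  have := hle ζ hζ
  rw [Real.norm_eq_abs, abs_of_nonneg (inv_nonneg.2 (hκ.le.trans this))]
  gcongr

theorem div_sqrt_le_integral {g : ℝ → ℝ} {θ : ℝ} (hθ : 1 < θ)
    (hpos : ∀ s : ℝ, 0 < s → 0 < g s)
    (hinf : ∀ K : Set ℝ, IsCompact K → K ⊆ Ioi 0 → K.Nonempty → 0 < sInf (g '' K))
    {m₁ m₂ : ℝ} (hm₁ : 0 < m₁) (hm : m₁ ≤ m₂) (hm₂ : m₂ ≤ θ * m₁) :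
    (m₂ - m₁) / Real.sqrt (sInf (g '' Icc m₁ m₂) * m₂)
      ≤ ∫ ζ in m₁..m₂, (Real.sqrt (sInf (g '' Ioo (ζ / θ) (θ * ζ)) * ζ))⁻¹ := by
  obtain ⟨κ, hκ, hle⟩ := sInf_image_Ioo_lower hθ hpos hinf hm₁ hm
  have := intervalIntegral.integral_mono_on_of_le_Ioo (μ := volume) hm
    (intervalIntegrable_const (c := (Real.sqrt (sInf (g '' Icc m₁ m₂) * m₂))⁻¹))
    (intervalIntegrable_inv_sqrt_sInf_mul hθ hpos hinf hm₁ hm) fun ζ hζ => by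
      have h1 := sInf_image_Ioo_le_sInf_image_Icc hθ hpos hm₁ hm₂ hζ
      have h2 : 0 < sInf (g '' Ioo (ζ / θ) (θ * ζ)) :=
        hκ.trans_le (hle ζ ⟨hζ.1.le, hζ.2.le⟩)
      have h3 : 0 < ζ := hm₁.trans hζ.1
      have h4 := hζ.2.le
      have h5 := h2.le.trans h1
      gcongr
  rwa [intervalIntegral.integral_const, smul_eq_mul, ← div_eq_mul_inv] at this

theorem div_sInf_le_integral {h : ℝ → ℝ} {θ : ℝ} (hθ : 1 < θ)
    (hpos : ∀ s : ℝ, 0 < s → 0 < h s)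
    (hinf : ∀ K : Set ℝ, IsCompact K → K ⊆ Ioi 0 → K.Nonempty → 0 < sInf (h '' K))
    {m₁ m₂ : ℝ} (hm₁ : 0 < m₁) (hm : m₁ ≤ m₂) (hm₂ : m₂ ≤ θ * m₁) :
    (m₂ - m₁) / sInf (h '' Icc m₁ m₂)
      ≤ ∫ ζ in m₁..m₂, (sInf (h '' Ioo (ζ / θ) (θ * ζ)))⁻¹ := by
  obtain ⟨κ, hκ, hle⟩ := sInf_image_Ioo_lower hθ hpos hinf hm₁ hm
  have := intervalIntegral.integral_mono_on_of_le_Ioo (μ := volume) hm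
    (intervalIntegrable_const (c := (sInf (h '' Icc m₁ m₂))⁻¹))
    (intervalIntegrable_inv_sInf hθ hpos hinf hm₁ hm) fun ζ hζ => by
      have h1 := sInf_image_Ioo_le_sInf_image_Icc hθ hpos hm₁ hm₂ hζ
      have h2 : 0 < sInf (h '' Ioo (ζ / θ) (θ * ζ)) :=
        hκ.trans_le (hle ζ ⟨hζ.1.le, hζ.2.le⟩)
      gcongr
  rwa [intervalIntegral.integral_const, smul_eq_mul, ← div_eq_mul_inv] at this

theorem integral_inv_sqrt_sInf_mul_nonneg {g : ℝ → ℝ} {θ m₁ m₂ : ℝ} (hm : m₁ ≤ m₂) :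
    0 ≤ ∫ ζ in m₁..m₂, (Real.sqrt (sInf (g '' Ioo (ζ / θ) (θ * ζ)) * ζ))⁻¹ :=
  intervalIntegral.integral_nonneg hm fun _ _ => by positivity

theorem integral_inv_sInf_nonneg {h : ℝ → ℝ} {θ m₁ m₂ : ℝ} (hθ : 1 < θ)
    (hpos : ∀ s : ℝ, 0 < s → 0 < h s) (hm₁ : 0 < m₁) (hm : m₁ ≤ m₂) :
    0 ≤ ∫ ζ in m₁..m₂, (sInf (h '' Ioo (ζ / θ) (θ * ζ)))⁻¹ := by
  refine intervalIntegral.integral_nonneg hm fun ζ hζ => inv_nonneg.2 (Real.sInf_nonneg ?_)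
  rintro _ ⟨s, hs, rfl⟩
  have : 0 < ζ := hm₁.trans_le hζ.1
  exact (hpos s (lt_trans (div_pos this (by linarith)) hs.1)).le

theorem integral_sInf_ball_le {n : ℕ} {p : Eucl n → ℝ} (hp : ∀ x, 0 ≤ p x) {r : ℝ} (hr : 0 < r) :
    (∫ ρ in r..(2 * r), Real.sqrt (sInf (p '' ball (0 : Eucl n) (2 * ρ)))
      ≤ r * Real.sqrt (sInf (p '' ball (0 : Eucl n) (2 * r)))) ∧
    (∫ ρ in r..(2 * r), ρ * sInf (p '' ball (0 : Eucl n) (2 * ρ))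
      ≤ 2 * r ^ 2 * sInf (p '' ball (0 : Eucl n) (2 * r))) := by
  have hq0 : ∀ ρ, 0 ≤ sInf (p '' ball (0 : Eucl n) (2 * ρ)) := fun ρ => by
    refine Real.sInf_nonneg ?_
    rintro _ ⟨x, -, rfl⟩
    exact hp x
  have hq : ∀ ρ ∈ uIoc r (2 * r), r < ρ ∧ ρ ≤ 2 * r ∧
      sInf (p '' ball (0 : Eucl n) (2 * ρ)) ≤ sInf (p '' ball (0 : Eucl n) (2 * r)) := by
    intro ρ hρ
    rw [uIoc_of_le (by linarith)] at hρ
    refine ⟨hρ.1, hρ.2, csInf_le_csInf ⟨0, ?_⟩ ?_ (image_mono (ball_subset_ball ?_))⟩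
    · rintro _ ⟨x, -, rfl⟩
      exact hp x
    · exact Nonempty.image _ (nonempty_ball.2 (by linarith))
    · linarith [hρ.1]
  have habs : |2 * r - r| = r := by rw [abs_of_nonneg] <;> linarith
  constructor
  · refine (le_abs_self _).trans ?_
    have := intervalIntegral.norm_integral_le_of_norm_le_const (a := r) (b := 2 * r)
      (f := fun ρ => Real.sqrt (sInf (p '' ball (0 : Eucl n) (2 * ρ))))
      (C := Real.sqrt (sInf (p '' ball (0 : Eucl n) (2 * r)))) fun ρ hρ => by
        rw [Real.norm_eq_abs, abs_of_nonneg (Real.sqrt_nonneg _)]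
        exact Real.sqrt_le_sqrt (hq ρ hρ).2.2
    rw [habs, Real.norm_eq_abs] at this
    linarith
  · refine (le_abs_self _).trans ?_
    have := intervalIntegral.norm_integral_le_of_norm_le_const (a := r) (b := 2 * r)
      (f := fun ρ => ρ * sInf (p '' ball (0 : Eucl n) (2 * ρ)))
      (C := 2 * r * sInf (p '' ball (0 : Eucl n) (2 * r))) fun ρ hρ => by
        obtain ⟨h1, h2, h3⟩ := hq ρ hρ
        rw [Real.norm_eq_abs, abs_of_nonneg (mul_nonneg (by linarith) (hq0 ρ))]
        exact mul_le_mul h2 h3 (hq0 ρ) (by linarith)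
    rw [habs, Real.norm_eq_abs] at this
    linarith

/-- **Lemma 3.3.** There is a constant `C > 0` depending only on `n` and `θ` such that
for any classical solution `u` of the parabolic inequality (under the structural
assumptions) and any `r > 0`, `t > 0` with `4r² < t` and
`M₂ = sup_{Q_{2r}^{t−4r²,t}} u ≥ √θ · sup_{Q_r^{t−r²,t}} u = √θ · M₁ > 0`, at least one
of the estimates (i) `∫_{M₁}^{M₂} (g_θ(ζ)ζ)^{-1/2} dζ ≥ C ∫_r^{2r} q^{1/2}(2ρ) dρ` or
(ii) `∫_{M₁}^{M₂} dζ/h_θ(ζ) ≥ C ∫_r^{2r} ρ q(2ρ) dρ` holds. -/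
theorem lemma_3_3
    (n : ℕ) (hn : 1 ≤ n) (θ : ℝ) (hθ : 1 < θ) :
    ∃ C : ℝ, 0 < C ∧
      ∀ (a : Eucl n → ℝ → Fin n → Fin n → ℝ)
        (f : Eucl n → ℝ → Eucl n → ℝ)
        (g h : ℝ → ℝ) (p : Eucl n → ℝ)
        (u : Eucl n → ℝ → ℝ) (du : Eucl n → ℝ → Eucl n)
        (d2u : Eucl n → ℝ → Fin n → Fin n → ℝ) (ut : Eucl n → ℝ → ℝ),
        -- ellipticity
        (∀ (x : Eucl n) (ζ : ℝ), ζ ≠ 0 → ∀ ξ : Eucl n, ξ ≠ 0 →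
          0 < ∑ i, ∑ j, a x ζ i j * ξ i * ξ j) →
        -- g, h : (0,∞) → (0,∞) measurable, locally bounded, positive inf on compacts
        Measurable g → Measurable h →
        (∀ s : ℝ, 0 < s → 0 < g s) → (∀ s : ℝ, 0 < s → 0 < h s) →
        (∀ K : Set ℝ, IsCompact K → K ⊆ Ioi 0 → BddAbove (g '' K)) →
        (∀ K : Set ℝ, IsCompact K → K ⊆ Ioi 0 → BddAbove (h '' K)) →
        (∀ K : Set ℝ, IsCompact K → K ⊆ Ioi 0 → K.Nonempty → 0 < sInf (g '' K)) →
        (∀ K : Set ℝ, IsCompact K → K ⊆ Ioi 0 → K.Nonempty → 0 < sInf (h '' K)) →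
        -- p : ℝⁿ → [0,∞) measurable and locally bounded
        Measurable p → (∀ x, 0 ≤ p x) →
        (∀ K : Set (Eucl n), IsCompact K → BddAbove (p '' K)) →
        -- the structural condition (1.2)
        (∀ (x : Eucl n) (ζ : ℝ), ζ ≠ 0 → ∀ lam : ℝ, 0 ≤ lam → lam ≤ p x * h |ζ| →
          p x * g |ζ| * (1 + ∑ i, ∑ j, |a x ζ i j|) ≤ f x ζ (lam • x) * Real.sign ζ) →
        -- `u` is a classical solution of the differential inequality
        (∀ (x : Eucl n) (t : ℝ), 0 < t → ∀ i,
          HasDerivAt (fun s : ℝ => u (x + s • EuclideanSpace.single i (1 : ℝ)) t)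
            (du x t i) 0) →
        (∀ (x : Eucl n) (t : ℝ), 0 < t → ∀ i j,
          HasDerivAt (fun s : ℝ => du (x + s • EuclideanSpace.single j (1 : ℝ)) t i)
            (d2u x t i j) 0) →
        (∀ (x : Eucl n) (t : ℝ), 0 < t → HasDerivAt (fun τ : ℝ => u x τ) (ut x t) t) →
        ContinuousOn (fun q : Eucl n × ℝ => u q.1 q.2) (univ ×ˢ Ioi 0) →
        (∀ i, ContinuousOn (fun q : Eucl n × ℝ => du q.1 q.2 i) (univ ×ˢ Ioi 0)) →
        (∀ i j, ContinuousOn (fun q : Eucl n × ℝ => d2u q.1 q.2 i j) (univ ×ˢ Ioi 0)) →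
        ContinuousOn (fun q : Eucl n × ℝ => ut q.1 q.2) (univ ×ˢ Ioi 0) →
        (∀ (x : Eucl n) (t : ℝ), 0 < t →
          ut x t - (∑ i, ∑ j, a x (u x t) i j * d2u x t i j) + f x (u x t) (du x t) ≤ 0) →
        -- the radii, times and suprema
        ∀ r t M₁ M₂ : ℝ,
          0 < r → 4 * r ^ 2 < t →
          M₁ = sSup ((fun q : Eucl n × ℝ => u q.1 q.2) ''
            (ball (0 : Eucl n) r ×ˢ Ioo (t - r ^ 2) t)) →
          M₂ = sSup ((fun q : Eucl n × ℝ => u q.1 q.2) ''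
            (ball (0 : Eucl n) (2 * r) ×ˢ Ioo (t - 4 * r ^ 2) t)) →
          0 < M₁ → Real.sqrt θ * M₁ ≤ M₂ →
          (C * ∫ ρ in r..(2 * r), Real.sqrt (sInf (p '' ball (0 : Eucl n) (2 * ρ)))
              ≤ ∫ ζ in M₁..M₂, (Real.sqrt (sInf (g '' Ioo (ζ / θ) (θ * ζ)) * ζ))⁻¹ ∨
           C * ∫ ρ in r..(2 * r), ρ * sInf (p '' ball (0 : Eucl n) (2 * ρ))
              ≤ ∫ ζ in M₁..M₂, (sInf (h '' Ioo (ζ / θ) (θ * ζ)))⁻¹) := by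
  have hsθ : 1 < Real.sqrt θ := by rw [Real.lt_sqrt (by norm_num)]; simpa using hθ
  have hsθ2 : Real.sqrt θ ^ 2 = θ := Real.sq_sqrt (by linarith)
  set c₀ := 1 - 1 / Real.sqrt θ with hc₀
  have hc₀0 : 0 < c₀ := by
    rw [hc₀, sub_pos, div_lt_one (by linarith)]
    exact hsθ
  set K := Real.sqrt (54 / c₀) with hKdef
  have hK0 : 0 < K := Real.sqrt_pos.2 (by positivity)
  refine ⟨1 / (K + 12), by positivity, ?_⟩
  intro a f g h p u du d2u ut hell _ _ hg hh _ _ hgi hhi _ hp _ hst hdu hd2u hut cu cdu cd2u _ hpde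
    r t M₁ M₂ hr ht hM₁ hM₂ hM₁0 hM₁₂
  set Q := sInf (p '' ball (0 : Eucl n) (2 * r)) with hQdef
  have hQ0 : 0 ≤ Q := by
    refine Real.sInf_nonneg ?_
    rintro _ ⟨x, -, rfl⟩
    exact hp x
  have hQp : ∀ x, ‖x‖ < 2 * r → Q ≤ p x := fun x hx => by
    refine csInf_le ⟨0, ?_⟩ (mem_image_of_mem p (by simpa using hx))
    rintro _ ⟨x, -, rfl⟩
    exact hp x
  obtain ⟨hI₁, hI₂⟩ := integral_sInf_ball_le hp hr
  rw [← hQdef] at hI₁ hI₂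
  have hM : M₁ ≤ M₂ := by nlinarith
  set G : ℝ → ℝ → ℝ := fun b c => ∫ ζ in b..c, (Real.sqrt (sInf (g '' Ioo (ζ / θ) (θ * ζ)) * ζ))⁻¹
    with hGdef
  set H : ℝ → ℝ → ℝ := fun b c => ∫ ζ in b..c, (sInf (h '' Ioo (ζ / θ) (θ * ζ)))⁻¹ with hHdef
  change _ ≤ G M₁ M₂ ∨ _ ≤ H M₁ M₂
  have hG0 : ∀ b c, b ≤ c → 0 ≤ G b c := fun b c hbc => integral_inv_sqrt_sInf_mul_nonneg hbc
  have hH0 : ∀ b c, 0 < b → b ≤ c → 0 ≤ H b c := fun b c hb hbc =>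
    integral_inv_sInf_nonneg hθ hh hb hbc
  rcases hQ0.eq_or_lt with hQz | hQpos
  · left
    rw [← hQz, Real.sqrt_zero, mul_zero] at hI₁
    exact (mul_nonpos_of_nonneg_of_nonpos (by positivity) hI₁).trans (hG0 _ _ hM)
  -- the maximum over closed cylinders
  set τ := t - 4 * r ^ 2 with hτ
  have hτ0 : 0 < τ := by linarith
  let v : Eucl n × ℝ → ℝ := fun q => u q.1 (max q.2 τ)
  have hv : Continuous v := cu.comp_continuous (f := fun q : Eucl n × ℝ => (q.1, max q.2 τ))
    (by fun_prop) fun q => ⟨mem_univ _, lt_max_of_lt_right hτ0⟩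
  let cyl : ℝ → Set (Eucl n × ℝ) := fun ρ => closedBall (0 : Eucl n) ρ ×ˢ Icc (t - ρ ^ 2) t
  let N : ℝ → ℝ := fun ρ => sSup (v '' cyl ρ)
  have hcpt : ∀ ρ, IsCompact (cyl ρ) := fun ρ => (isCompact_closedBall _ _).prod isCompact_Icc
  have hcyl : ∀ ρ, 0 < ρ → ρ ≤ 2 * r → ∀ x s, s ∈ Icc (t - ρ ^ 2) t → v (x, s) = u x s := by
    intro ρ hρ hρ2 x s hs
    have : τ ≤ s := by
      have := hs.1
      nlinarith
    simp [v, max_eq_left this]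
  have hopen : ∀ ρ, 0 < ρ → ρ ≤ 2 * r → N ρ = sSup ((fun q : Eucl n × ℝ => u q.1 q.2) ''
      (ball (0 : Eucl n) ρ ×ˢ Ioo (t - ρ ^ 2) t)) := by
    intro ρ hρ hρ2
    have hlt : t - ρ ^ 2 < t := by have := pow_pos hρ 2; linarith
    have hcl : closure (ball (0 : Eucl n) ρ ×ˢ Ioo (t - ρ ^ 2) t) = cyl ρ := by
      rw [closure_prod_eq, closure_ball _ hρ.ne', closure_Ioo hlt.ne]
    have := sSup_image_closure_eq hv ((nonempty_ball.2 hρ).prod (nonempty_Ioo.2 hlt))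
      (hcl ▸ hcpt ρ)
    rw [hcl] at this
    simp only [N]
    rw [← this]
    congr 1
    refine image_congr ?_
    rintro ⟨x, s⟩ ⟨-, hs⟩
    exact hcyl ρ hρ hρ2 x s ⟨hs.1.le, hs.2.le⟩
  have hN₁ : N r = M₁ := by rw [hopen r hr (by linarith), hM₁]
  have hN₂ : N (2 * r) = M₂ := by
    rw [hopen (2 * r) (by linarith) le_rfl, hM₂]
    congr! 4
    ring
  have hNc : ContinuousOn N (Icc r (2 * r)) :=
    (continuousOn_sSup_cylinder hv t).mono fun ρ hρ => hr.trans_le hρ.1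
  let Φ : ℝ → ℝ → ℝ := fun b c => K / Real.sqrt Q * G b c + 6 / (r * Q) * H b c
  have hsQ : 0 < Real.sqrt Q := Real.sqrt_pos.2 hQpos
  have hΦ : ∀ b c d, 0 < b → b ≤ c → c ≤ d → Φ b c + Φ c d = Φ b d := by
    intro b c d hb hbc hcd
    have hc : 0 < c := hb.trans_le hbc
    have e1 : G b c + G c d = G b d := intervalIntegral.integral_add_adjacent_intervals
      (intervalIntegrable_inv_sqrt_sInf_mul hθ hg hgi hb hbc)
      (intervalIntegrable_inv_sqrt_sInf_mul hθ hg hgi hc hcd)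
    have e2 : H b c + H c d = H b d := intervalIntegral.integral_add_adjacent_intervals
      (intervalIntegrable_inv_sInf hθ hh hhi hb hbc)
      (intervalIntegrable_inv_sInf hθ hh hhi hc hcd)
    simp only [Φ, ← e1, ← e2]
    ring
  have hstep : ∀ ρ₁ ρ₂, r ≤ ρ₁ → ρ₁ < ρ₂ → ρ₂ ≤ 2 * r → 0 < N ρ₁ → Real.sqrt θ * N ρ₁ ≤ N ρ₂ →
      N ρ₂ ≤ Real.sqrt θ ^ 2 * N ρ₁ → ρ₂ - ρ₁ ≤ Φ (N ρ₁) (N ρ₂) := by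
    intro ρ₁ ρ₂ h1 h12 h2 hpos hlo hup
    rw [hsθ2] at hup
    have hρ₁ : 0 < ρ₁ := hr.trans_le h1
    have hρ₂ : 0 < ρ₂ := hρ₁.trans h12
    have hle : ∀ x s, ‖x‖ ≤ ρ₂ → s ∈ Icc (t - ρ₂ ^ 2) t → u x s ≤ N ρ₂ := fun x s hx hs => by
      rw [← hcyl ρ₂ hρ₂ h2 x s hs]
      exact le_csSup ((hcpt ρ₂).image hv).bddAbove
        (mem_image_of_mem v ⟨by simpa using hx, hs⟩)
    have hex : ∃ x s, ‖x‖ ≤ ρ₁ ∧ s ∈ Icc (t - ρ₁ ^ 2) t ∧ u x s = N ρ₁ := by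
      have hne : (cyl ρ₁).Nonempty :=
        ⟨(0, t), by simpa using hρ₁.le, by constructor <;> simp only <;> nlinarith⟩
      obtain ⟨⟨x, s⟩, ⟨hx, hs⟩, hxs⟩ := ((hcpt ρ₁).image hv).sSup_mem (hne.image v)
      refine ⟨x, s, by simpa using hx, hs, ?_⟩
      rw [← hcyl ρ₁ hρ₁ (h12.le.trans h2) x s hs]
      exact hxs
    generalize N ρ₁ = m₁ at *
    generalize N ρ₂ = m₂ at *
    have hm : m₁ < m₂ := by nlinarith
    have hm₂ : 0 < m₂ := hpos.trans hm
    have hIcc : Icc m₁ m₂ ⊆ Ioi 0 := fun s hs => hpos.trans_le hs.1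
    have hγ := hgi _ isCompact_Icc hIcc (nonempty_Icc.2 hm.le)
    have hη := hhi _ isCompact_Icc hIcc (nonempty_Icc.2 hm.le)
    have hbdd : ∀ φ : ℝ → ℝ, (∀ s, 0 < s → 0 < φ s) → ∀ s ∈ Icc m₁ m₂,
        sInf (φ '' Icc m₁ m₂) ≤ φ s := fun φ hφ s hs => by
      refine csInf_le ⟨0, ?_⟩ (mem_image_of_mem φ hs)
      rintro _ ⟨z, hz, rfl⟩
      exact (hφ z (hIcc hz)).le
    have hgrowth := subsolution_max_growth hell (fun x ζ hζ lam h0 h1 => by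
        have := hst x ζ hζ.ne' lam h0 (by rwa [abs_of_pos hζ])
        rwa [abs_of_pos hζ, Real.sign_of_pos hζ, mul_one] at this)
      hdu hd2u hut cu cdu cd2u hpde hr ht h1 h12 h2 hpos hm hle hex hQ0 hQp
      hγ.le (hbdd g hg) hη.le (hbdd h hh)
    have hGl : _ ≤ G m₁ m₂ := div_sqrt_le_integral hθ hg hgi hpos hm.le hup
    have hHl : _ ≤ H m₁ m₂ := div_sInf_le_integral hθ hh hhi hpos hm.le hup
    have hG0' := hG0 m₁ m₂ hm.le
    have hH0' := hH0 m₁ m₂ hpos hm.le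
    generalize sInf (g '' Icc m₁ m₂) = γ at *
    generalize sInf (h '' Icc m₁ m₂) = η at *
    simp only [Φ]
    rcases hgrowth with hA | hB
    · have hc₀m : c₀ * m₂ ≤ m₂ - m₁ := by
        have : m₁ ≤ m₂ / Real.sqrt θ := by
          rw [le_div_iff₀ (by linarith)]; linarith
        rw [hc₀, sub_mul, one_mul, one_div_mul_eq_div]
        linarith
      have hA' : ρ₂ - ρ₁ ≤ K / Real.sqrt Q * ((m₂ - m₁) / Real.sqrt (γ * m₂)) := by
        have hδ : 0 < m₂ - m₁ := by linarith
        rw [← pow_le_pow_iff_left₀ (by linarith) (by positivity) two_ne_zero, mul_pow, div_pow,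
          div_pow, hKdef, Real.sq_sqrt (by positivity), Real.sq_sqrt hQ0,
          Real.sq_sqrt (by positivity)]
        calc (ρ₂ - ρ₁) ^ 2 ≤ 54 * (m₂ - m₁) / (Q * γ) := by
              rw [le_div_iff₀ (by positivity)]; exact hA
          _ = 54 * (m₂ - m₁) * (c₀ * m₂) / (Q * γ * (c₀ * m₂)) := by field_simp
          _ ≤ 54 * (m₂ - m₁) * (m₂ - m₁) / (Q * γ * (c₀ * m₂)) := by gcongr
          _ = _ := by field_simp
      calc ρ₂ - ρ₁ ≤ _ := hA'
        _ ≤ K / Real.sqrt Q * G m₁ m₂ := by gcongr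
        _ ≤ _ := le_add_of_nonneg_right (by positivity)
    · have hB' : ρ₂ - ρ₁ ≤ 6 / (r * Q) * ((m₂ - m₁) / η) := by
        rw [div_mul_div_comm, le_div_iff₀ (by positivity)]
        linarith
      calc ρ₂ - ρ₁ ≤ _ := hB'
        _ ≤ 6 / (r * Q) * H m₁ m₂ := by gcongr
        _ ≤ _ := le_add_of_nonneg_left (by positivity)
  have hfinal := sub_le_of_geometric_steps hsθ hNc hΦ hstep (by linarith) (by rwa [hN₁])
    (by rwa [hN₁, hN₂])
  rw [hN₁, hN₂] at hfinal
  by_contra! hcon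
  obtain ⟨hcG, hcH⟩ := hcon
  have hcG' : G M₁ M₂ < 1 / (K + 12) * (r * Real.sqrt Q) :=
    hcG.trans_le (by gcongr)
  have hcH' : H M₁ M₂ < 1 / (K + 12) * (2 * r ^ 2 * Q) :=
    hcH.trans_le (by gcongr)
  have : Φ M₁ M₂ < r := by
    calc Φ M₁ M₂ < K / Real.sqrt Q * (1 / (K + 12) * (r * Real.sqrt Q))
          + 6 / (r * Q) * (1 / (K + 12) * (2 * r ^ 2 * Q)) := by
          simp only [Φ]
          gcongr
      _ = r := by
          field_simp
          ring
  linarith
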